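/- arXiv:2410.06776 — 7 statements merged into one kernel-verified Lean document; each statement's English description precedes it below -/
import Mathlib

section
/- Let n ≥ 1 and let f, φ, ψ ∈ 𝒮(ℝⁿ) with φ, ψ ≠ 0 and (ψ,φ) ≠ 0, where (ψ,φ) = ∫_{ℝⁿ} ψ(x) conj(φ(x)) dx. Then for every x ∈ ℝⁿ, f(x) = (2π)^{−n} (ψ,φ)^{−1} ∬_{ℝ²ⁿ} ψ(x−y) W_φ f(y,ξ) e^{i x·ξ} dy dξ (inversion formula for the wave packet transform). -/
open MeasureTheory Complex Real
open scoped InnerProductSpace ENNReal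

/-- The wave packet transform of `f` with window function `φ`:
`W_φ f (x, ξ) = ∫ conj (φ (y - x)) * f y * exp (- i ⟨y, ξ⟩) dy`. -/
noncomputable def wavePacket {n : ℕ} (φ f : EuclideanSpace ℝ (Fin n) → ℂ)
    (x ξ : EuclideanSpace ℝ (Fin n)) : ℂ :=
  ∫ y, (starRingEnd ℂ) (φ (y - x)) * f y * Complex.exp (-(Complex.I * (⟪y, ξ⟫_ℝ : ℂ)))

namespace SchwartzMap

open FourierTransform Convolution ContinuousLinearMap

variable {V : Type*} [NormedAddCommGroup V] [InnerProductSpace ℝ V]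

/-- The Schwartz function `x ↦ conj (f x)`. -/
noncomputable def conj (f : SchwartzMap V ℂ) : SchwartzMap V ℂ :=
  postcompCLM (conjCLE : ℂ →L[ℝ] ℂ) f

@[simp]
theorem conj_apply (f : SchwartzMap V ℂ) (x : V) : f.conj x = (starRingEnd ℂ) (f x) := rfl

/-- The Schwartz function `y ↦ f (x - y)`. -/
noncomputable def constSub (f : SchwartzMap V ℂ) (x : V) : SchwartzMap V ℂ :=
  compSubConstCLM ℝ x (compCLMOfContinuousLinearEquiv ℝ (ContinuousLinearEquiv.neg ℝ) f)

@[simp]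
theorem constSub_apply (f : SchwartzMap V ℂ) (x y : V) : f.constSub x y = f (x - y) := by
  simp [constSub]

variable [FiniteDimensional ℝ V] [MeasurableSpace V] [BorelSpace V]

/-- Fourier inversion for Schwartz functions in the angular frequency normalization. -/
theorem integral_fourier_inv_two_pi_smul_mul_exp (g : SchwartzMap V ℂ) (x : V) :
    ∫ ξ : V, 𝓕 g ((2 * Real.pi)⁻¹ • ξ) * Complex.exp (Complex.I * (⟪x, ξ⟫_ℝ : ℂ)) =
      (((2 * Real.pi) ^ Module.finrank ℝ V : ℝ) : ℂ) * g x := by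
  have hinv : 𝓕⁻ (𝓕 g) x = g x := by simp
  rw [fourierInv_coe, Real.fourierInv_eq'] at hinv
  rw [← hinv, ← Complex.real_smul, ← Measure.integral_comp_inv_smul_of_nonneg _ _ (by positivity)]
  refine integral_congr_ae (.of_forall fun ξ ↦ ?_)
  have hpi : 2 * Real.pi * ⟪(2 * Real.pi)⁻¹ • ξ, x⟫_ℝ = ⟪x, ξ⟫_ℝ := by
    rw [inner_smul_left, real_inner_comm]
    simp
    field_simp
  simp only [hpi, smul_eq_mul]
  ring_nf

end SchwartzMap

open FourierTransform SchwartzMap in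
/-- Averaging the wave packet transform of `f` in position against `a` is the Fourier transform of
the product of `f` with the convolution of `a` and the conjugate window. -/
theorem integral_mul_wavePacket {n : ℕ} (a f φ : SchwartzMap (EuclideanSpace ℝ (Fin n)) ℂ)
    (ξ : EuclideanSpace ℝ (Fin n)) :
    ∫ y, a y * wavePacket φ f y ξ =
      𝓕 (pairing (.mul ℂ ℂ) f (convolution (.mul ℂ ℂ) a φ.conj)) ((2 * Real.pi)⁻¹ • ξ) := by
  have hint : Integrable (fun p : EuclideanSpace ℝ (Fin n) × EuclideanSpace ℝ (Fin n) ↦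
      (a p.2 * φ.conj (p.1 - p.2)) *
        (f p.1 * Complex.exp (-(Complex.I * (⟪p.1, ξ⟫_ℝ : ℂ))))) (volume.prod volume) := by
    refine (a.integrable.convolution_integrand (.mul ℂ ℂ) φ.conj.integrable).mul_bdd
      (c := SchwartzMap.seminorm ℝ 0 0 f) ?_ (.of_forall fun p ↦ ?_)
    · have := f.continuous
      exact Continuous.aestronglyMeasurable (by fun_prop)
    · simpa [Complex.norm_exp] using norm_le_seminorm ℝ f p.1
  rw [fourier_coe, Real.fourier_eq']
  calc
    _ = ∫ y, ∫ z, (a y * φ.conj (z - y)) *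
        (f z * Complex.exp (-(Complex.I * (⟪z, ξ⟫_ℝ : ℂ)))) := by
      simp only [wavePacket, ← integral_const_mul, conj_apply]
      simp only [mul_assoc]
    _ = ∫ z, ∫ y, (a y * φ.conj (z - y)) *
        (f z * Complex.exp (-(Complex.I * (⟪z, ξ⟫_ℝ : ℂ)))) :=
      (integral_integral_swap hint).symm
    _ = _ := by
      refine integral_congr_ae (.of_forall fun z ↦ ?_)
      have hpi : -2 * Real.pi * ⟪z, (2 * Real.pi)⁻¹ • ξ⟫_ℝ = -⟪z, ξ⟫_ℝ := by
        rw [inner_smul_right]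
        field_simp
      simp only [hpi, integral_mul_const, pairing_apply_apply, convolution_apply,
        MeasureTheory.convolution_def, ContinuousLinearMap.mul_apply', smul_eq_mul]
      push_cast
      ring_nf

/-- Inversion formula for the wave packet transform: for Schwartz functions
`f, φ, ψ` with `φ, ψ ≠ 0` and `(ψ, φ) = ∫ ψ conj φ ≠ 0`, one has, for every `x`,
`f x = (2π)^{-n} (ψ,φ)⁻¹ ∬ ψ (x - y) • W_φ f (y, ξ) • e^{i x·ξ} dy dξ`. -/
theorem wavePacket_inversion (n : ℕ) (hn : 1 ≤ n)
    (f φ ψ : SchwartzMap (EuclideanSpace ℝ (Fin n)) ℂ) (hφ : φ ≠ 0) (hψ : ψ ≠ 0)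
    (hpair : (∫ x, ψ x * (starRingEnd ℂ) (φ x)) ≠ 0) :
    ∀ x : EuclideanSpace ℝ (Fin n),
      f x = ((((2 * Real.pi) ^ n)⁻¹ : ℝ) : ℂ) * (∫ x, ψ x * (starRingEnd ℂ) (φ x))⁻¹ *
        ∫ ξ : EuclideanSpace ℝ (Fin n), ∫ y : EuclideanSpace ℝ (Fin n),
          ψ (x - y) * wavePacket (⇑φ) (⇑f) y ξ * Complex.exp (Complex.I * (⟪x, ξ⟫_ℝ : ℂ)) := by
  intro x
  have hconv : SchwartzMap.convolution (.mul ℂ ℂ) (ψ.constSub x) φ.conj x =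
      ∫ y, ψ y * (starRingEnd ℂ) (φ y) := by
    rw [SchwartzMap.convolution_apply, MeasureTheory.convolution_def]
    simpa using integral_sub_left_eq_self (fun y ↦ ψ y * (starRingEnd ℂ) (φ y)) volume x
  have hpi : (((2 * Real.pi) ^ n : ℝ) : ℂ) ≠ 0 := by
    exact_mod_cast (by positivity : (2 * Real.pi) ^ n ≠ 0)
  simp only [integral_mul_const, ← SchwartzMap.constSub_apply, integral_mul_wavePacket,
    SchwartzMap.integral_fourier_inv_two_pi_smul_mul_exp, SchwartzMap.pairing_apply_apply,
    ContinuousLinearMap.mul_apply', hconv, finrank_euclideanSpace_fin]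
  rw [Complex.ofReal_inv]
  field_simp
end

section
/- Let n ≥ 1 and let f, α, β, γ ∈ 𝒮(ℝⁿ) with α, β, γ ≠ 0 and (β,γ) ≠ 0, where (β,γ) = ∫_{ℝⁿ} β(x) conj(γ(x)) dx. Then for all x, ξ ∈ ℝⁿ, |W_α f(x,ξ)| ≤ (2π)^{−n} |(β,γ)|^{−1} ∬_{ℝ²ⁿ} |W_α β(x−y, ξ−η)| · |W_γ f(y,η)| dy dη; that is, the wave packet transform with window α is pointwise dominated by the (x,ξ)-convolution of |W_α β| and |W_γ f|, up to the factor (2π)^{−n}|(β,γ)|^{−1}. -/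
open MeasureTheory Complex Real
open scoped InnerProductSpace ENNReal

open FourierTransform SchwartzMap in
/-- The Fourier transform of a product of Schwartz functions is the convolution of their
Fourier transforms. -/
theorem fourier_mul_eq_integral {n : ℕ} (f g : SchwartzMap (EuclideanSpace ℝ (Fin n)) ℂ)
    (ξ : EuclideanSpace ℝ (Fin n)) :
    𝓕 (fun x => f x * g x) ξ = ∫ η, 𝓕 f η * 𝓕 g (ξ - η) := by
  have hdouble (h : SchwartzMap (EuclideanSpace ℝ (Fin n)) ℂ) (x : EuclideanSpace ℝ (Fin n)) :
      𝓕 (𝓕 h) x = h (-x) := by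
    have := Real.fourierInv_eq_fourier_neg (𝓕 h : SchwartzMap (EuclideanSpace ℝ (Fin n)) ℂ) (-x)
    rw [neg_neg] at this
    rw [fourier_coe, ← this, ← fourierInv_coe, FourierTransform.fourierInv_fourier_eq]
  set B := ContinuousLinearMap.mul ℂ ℂ
  set C := SchwartzMap.convolution B (𝓕 f) (𝓕 g)
  have hC : 𝓕⁻ (𝓕 C) ξ = C ξ := by rw [FourierTransform.fourierInv_fourier_eq]
  rw [fourier_convolution, fourierInv_coe, Real.fourierInv_eq_fourier_comp_neg] at hC
  have hprod : (fun x => pairing B (𝓕 (𝓕 f)) (𝓕 (𝓕 g)) (-x)) = fun x => f x * g x := by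
    ext x
    simp [B, hdouble]
  rw [hprod] at hC
  rw [hC]
  exact SchwartzMap.convolution_apply B (𝓕 f) (𝓕 g) ξ

/-- The function `y ↦ conj (φ (y - x)) * f y` as a Schwartz function. -/
noncomputable def windowed {n : ℕ} (φ f : SchwartzMap (EuclideanSpace ℝ (Fin n)) ℂ)
    (x : EuclideanSpace ℝ (Fin n)) : SchwartzMap (EuclideanSpace ℝ (Fin n)) ℂ :=
  SchwartzMap.pairing (ContinuousLinearMap.mul ℝ ℂ)
    ((φ.postcompCLM (𝕜 := ℝ) (Complex.conjCLE : ℂ →L[ℝ] ℂ)).compSubConstCLM ℝ x) f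

theorem windowed_apply {n : ℕ} (φ f : SchwartzMap (EuclideanSpace ℝ (Fin n)) ℂ)
    (x y : EuclideanSpace ℝ (Fin n)) :
    windowed φ f x y = (starRingEnd ℂ) (φ (y - x)) * f y := rfl

theorem exp_neg_two_pi_inner_smul {n : ℕ} (y ξ : EuclideanSpace ℝ (Fin n)) :
    Complex.exp ((↑(-2 * π * ⟪y, (2 * π)⁻¹ • ξ⟫_ℝ) * Complex.I)) =
      Complex.exp (-(Complex.I * (⟪y, ξ⟫_ℝ : ℂ))) := by
  congr 1
  rw [real_inner_smul_right]
  push_cast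
  have : (π : ℂ) ≠ 0 := by exact_mod_cast Real.pi_ne_zero
  field_simp

open FourierTransform in
theorem wavePacket_eq_fourier {n : ℕ} (φ f : SchwartzMap (EuclideanSpace ℝ (Fin n)) ℂ)
    (x ξ : EuclideanSpace ℝ (Fin n)) :
    wavePacket φ f x ξ = 𝓕 (windowed φ f x) ((2 * π)⁻¹ • ξ) := by
  rw [SchwartzMap.fourier_coe, Real.fourier_eq', wavePacket]
  refine integral_congr_ae (.of_forall fun y => ?_)
  simp only [exp_neg_two_pi_inner_smul, windowed_apply, smul_eq_mul]
  ring

theorem norm_wavePacket_translate {n : ℕ} (φ f : EuclideanSpace ℝ (Fin n) → ℂ)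
    (x y ξ : EuclideanSpace ℝ (Fin n)) :
    ‖wavePacket φ (fun w => f (w - y)) x ξ‖ = ‖wavePacket φ f (x - y) ξ‖ := by
  have h : wavePacket φ (fun w => f (w - y)) x ξ =
      Complex.exp ((-⟪y, ξ⟫_ℝ : ℝ) * Complex.I) * wavePacket φ f (x - y) ξ := by
    rw [wavePacket, wavePacket, ← integral_add_right_eq_self _ y, ← integral_const_mul]
    refine integral_congr_ae (.of_forall fun w => ?_)
    simp only [add_sub_cancel_right, inner_add_left]
    rw [show w + y - x = w - (x - y) by abel, mul_left_comm, ← Complex.exp_add]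
    congr 2
    push_cast
    ring
  rw [h, norm_mul, Complex.norm_exp_ofReal_mul_I, one_mul]

theorem integral_comp_inv_two_pi_smul {n : ℕ} {F : Type*} [NormedAddCommGroup F]
    [NormedSpace ℝ F] (g : EuclideanSpace ℝ (Fin n) → F) :
    ∫ ξ, g ((2 * π)⁻¹ • ξ) = ((2 * π) ^ n) • ∫ ξ, g ξ := by
  rw [Measure.integral_comp_smul, finrank_euclideanSpace_fin, inv_pow, inv_inv,
    abs_of_pos (by positivity)]

theorem stronglyMeasurable_wavePacket {n : ℕ} (φ f : SchwartzMap (EuclideanSpace ℝ (Fin n)) ℂ) :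
    StronglyMeasurable fun p : EuclideanSpace ℝ (Fin n) × EuclideanSpace ℝ (Fin n) =>
      wavePacket φ f p.1 p.2 := by
  have hcont : Continuous fun q : (EuclideanSpace ℝ (Fin n) × EuclideanSpace ℝ (Fin n)) ×
      EuclideanSpace ℝ (Fin n) => (starRingEnd ℂ) (φ (q.2 - q.1.1)) * f q.2 *
        Complex.exp (-(Complex.I * (⟪q.2, q.1.2⟫_ℝ : ℂ))) := by
    have := φ.continuous
    have := f.continuous
    have := Complex.continuous_conj
    fun_prop
  exact hcont.stronglyMeasurable.integral_prod_right'

theorem SchwartzMap.integrable_norm_sq {n : ℕ} (f : SchwartzMap (EuclideanSpace ℝ (Fin n)) ℂ) :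
    Integrable fun x => ‖f x‖ ^ 2 :=
  (memLp_two_iff_integrable_sq_norm f.continuous.aestronglyMeasurable).1 (f.memLp 2)

open FourierTransform in
theorem memLp_wavePacket {n : ℕ} (φ f : SchwartzMap (EuclideanSpace ℝ (Fin n)) ℂ) :
    MemLp (fun p : EuclideanSpace ℝ (Fin n) × EuclideanSpace ℝ (Fin n) =>
      wavePacket φ f p.1 p.2) 2 := by
  have hmeas := stronglyMeasurable_wavePacket φ f
  rw [memLp_two_iff_integrable_sq_norm hmeas.aestronglyMeasurable]
  refine (integrable_prod_iff (hmeas.norm.pow 2).aestronglyMeasurable).2 ⟨.of_forall fun x => ?_, ?_⟩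
  · change Integrable fun ξ => ‖wavePacket φ f x ξ‖ ^ 2
    simp only [wavePacket_eq_fourier]
    exact (SchwartzMap.integrable_norm_sq (𝓕 (windowed φ f x))).comp_smul (R := (2 * π)⁻¹)
      (by positivity)
  · have hinner (x : EuclideanSpace ℝ (Fin n)) : ∫ ξ, ‖‖wavePacket φ f x ξ‖ ^ 2‖ =
        (2 * π) ^ n * ∫ w, ‖f w‖ ^ 2 * ‖φ (-(x - w))‖ ^ 2 := by
      simp only [norm_pow, norm_norm, wavePacket_eq_fourier]
      rw [integral_comp_inv_two_pi_smul fun ξ => ‖𝓕 (windowed φ f x) ξ‖ ^ 2,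
        SchwartzMap.integral_norm_sq_fourier, smul_eq_mul]
      congr 2 with w
      rw [windowed_apply, norm_mul, RCLike.norm_conj, neg_sub, mul_pow, mul_comm]
    change Integrable fun x => ∫ ξ, ‖‖wavePacket φ f x ξ‖ ^ 2‖
    simp only [hinner]
    exact ((f.integrable_norm_sq).integrable_convolution (ContinuousLinearMap.mul ℝ ℝ)
      φ.integrable_norm_sq.comp_neg).const_mul _

theorem integrable_wavePacket_convolution {n : ℕ}
    (f α β γ : SchwartzMap (EuclideanSpace ℝ (Fin n)) ℂ) (x ξ : EuclideanSpace ℝ (Fin n)) :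
    Integrable fun p : EuclideanSpace ℝ (Fin n) × EuclideanSpace ℝ (Fin n) =>
      ‖wavePacket α β (x - p.1) (ξ - p.2)‖ * ‖wavePacket γ f p.1 p.2‖ := by
  have hpres : MeasurePreserving (Prod.map (x - ·) (ξ - ·) :
      EuclideanSpace ℝ (Fin n) × EuclideanSpace ℝ (Fin n) → _) volume volume :=
    (Measure.measurePreserving_sub_left volume x).prod
      (Measure.measurePreserving_sub_left volume ξ)
  have hshift := (memLp_wavePacket α β).comp_measurePreserving hpres
  exact hshift.norm.integrable_mul (memLp_wavePacket γ f).norm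

open FourierTransform in
theorem norm_fourier_windowed_mul_le {n : ℕ}
    (f α β γ : SchwartzMap (EuclideanSpace ℝ (Fin n)) ℂ) (x ξ y : EuclideanSpace ℝ (Fin n)) :
    ‖𝓕 (fun w => windowed γ f y w * windowed α (β.compSubConstCLM ℝ y) x w) ((2 * π)⁻¹ • ξ)‖ ≤
      ((2 * π) ^ n)⁻¹ *
        ∫ η, ‖wavePacket α β (x - y) (ξ - η)‖ * ‖wavePacket γ f y η‖ := by
  have hbound (η : EuclideanSpace ℝ (Fin n)) :
      ‖wavePacket α β (x - y) (ξ - η)‖ * ‖wavePacket γ f y η‖ =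
        ‖𝓕 (windowed γ f y) ((2 * π)⁻¹ • η) *
          𝓕 (windowed α (β.compSubConstCLM ℝ y) x) ((2 * π)⁻¹ • ξ - (2 * π)⁻¹ • η)‖ := by
    rw [norm_mul, ← smul_sub, ← wavePacket_eq_fourier, ← wavePacket_eq_fourier,
      ← norm_wavePacket_translate, mul_comm]
    rfl
  simp only [hbound]
  rw [integral_comp_inv_two_pi_smul fun η => ‖𝓕 (windowed γ f y) η *
      𝓕 (windowed α (β.compSubConstCLM ℝ y) x) ((2 * π)⁻¹ • ξ - η)‖, smul_eq_mul,
    inv_mul_cancel_left₀ (by positivity), fourier_mul_eq_integral]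
  exact norm_integral_le_integral_norm _

open FourierTransform in
theorem integral_fourier_windowed_mul {n : ℕ}
    (f α β γ : SchwartzMap (EuclideanSpace ℝ (Fin n)) ℂ) (x ξ : EuclideanSpace ℝ (Fin n)) :
    ∫ y, 𝓕 (fun w => windowed γ f y w * windowed α (β.compSubConstCLM ℝ y) x w)
        ((2 * π)⁻¹ • ξ) =
      wavePacket α f x ξ * ∫ z, β z * (starRingEnd ℂ) (γ z) := by
  have hF : Integrable fun w => (starRingEnd ℂ) (α (w - x)) * f w *
      Complex.exp (-(Complex.I * (⟪w, ξ⟫_ℝ : ℂ))) := by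
    refine (windowed α f x).integrable (μ := volume) |>.mul_bdd (c := 1) ?_ (.of_forall fun w => ?_)
    · exact (by fun_prop : Continuous fun w : EuclideanSpace ℝ (Fin n) =>
        Complex.exp (-(Complex.I * (⟪w, ξ⟫_ℝ : ℂ)))).aestronglyMeasurable
    · rw [show -(Complex.I * (⟪w, ξ⟫_ℝ : ℂ)) = ((-⟪w, ξ⟫_ℝ : ℝ) : ℂ) * Complex.I by
        push_cast; ring, Complex.norm_exp_ofReal_mul_I]
  have hG : Integrable fun z => β z * (starRingEnd ℂ) (γ z) := by
    have h := (windowed γ β 0).integrable (μ := volume)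
    refine h.congr (.of_forall fun z => ?_)
    rw [windowed_apply, sub_zero, mul_comm]
  have hconv := integral_convolution (ContinuousLinearMap.mul ℂ ℂ) (μ := volume) (ν := volume)
    hF hG.comp_neg
  simp only [ContinuousLinearMap.mul_apply'] at hconv
  rw [integral_neg_eq_self fun z => β z * (starRingEnd ℂ) (γ z)] at hconv
  rw [wavePacket, ← hconv]
  refine integral_congr_ae (.of_forall fun y => ?_)
  simp only [Real.fourier_eq', exp_neg_two_pi_inner_smul, windowed_apply, smul_eq_mul,
    convolution_def, ContinuousLinearMap.mul_apply', SchwartzMap.compSubConstCLM_apply, neg_sub]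
  congr 1 with w
  ring

/-- For Schwartz functions `f, α, β, γ` with `α, β, γ ≠ 0` and
`(β,γ) = ∫ β conj γ ≠ 0`, the wave packet transform with window `α` is pointwise dominated
by the `(x,ξ)`-convolution of `|W_α β|` and `|W_γ f|` up to the factor `(2π)^{-n} |(β,γ)|⁻¹`:
`|W_α f (x,ξ)| ≤ (2π)^{-n} |(β,γ)|⁻¹ ∬ |W_α β (x-y, ξ-η)| |W_γ f (y,η)| dy dη`. -/
theorem wavePacket_convolution_bound (n : ℕ) (hn : 1 ≤ n)
    (f α β γ : SchwartzMap (EuclideanSpace ℝ (Fin n)) ℂ)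
    (hα : α ≠ 0) (hβ : β ≠ 0) (hγ : γ ≠ 0)
    (hpair : (∫ x, β x * (starRingEnd ℂ) (γ x)) ≠ 0) :
    ∀ x ξ : EuclideanSpace ℝ (Fin n),
      ‖wavePacket (⇑α) (⇑f) x ξ‖ ≤
        ((2 * Real.pi) ^ n)⁻¹ * ‖∫ x, β x * (starRingEnd ℂ) (γ x)‖⁻¹ *
          ∫ p : EuclideanSpace ℝ (Fin n) × EuclideanSpace ℝ (Fin n),
            ‖wavePacket (⇑α) (⇑β) (x - p.1) (ξ - p.2)‖ * ‖wavePacket (⇑γ) (⇑f) p.1 p.2‖ := by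
  intro x ξ
  set c := ∫ z, β z * (starRingEnd ℂ) (γ z)
  have hint := integrable_wavePacket_convolution f α β γ x ξ
  have hle : ‖wavePacket α f x ξ‖ * ‖c‖ ≤ ((2 * π) ^ n)⁻¹ *
      ∫ p : EuclideanSpace ℝ (Fin n) × EuclideanSpace ℝ (Fin n),
        ‖wavePacket α β (x - p.1) (ξ - p.2)‖ * ‖wavePacket γ f p.1 p.2‖ := by
    rw [← norm_mul, ← integral_fourier_windowed_mul, Measure.volume_eq_prod,
      integral_prod _ hint, ← integral_const_mul]
    exact norm_integral_le_of_norm_le (hint.integral_prod_left.const_mul _)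
      (.of_forall (norm_fourier_windowed_mul_le f α β γ x ξ))
  rw [mul_right_comm, ← div_eq_mul_inv]
  exact (le_div_iff₀ (norm_pos_iff.2 hpair)).2 hle
end

section
/- Let n ≥ 1, t ∈ ℝ and f, ψ ∈ 𝒮(ℝⁿ) with ψ ≠ 0. Then for all x, ξ ∈ ℝⁿ, W_{e^{itΔ/2}ψ}[e^{itΔ/2} f](x,ξ) = e^{−i t |ξ|²/2} W_ψ f(x − tξ, ξ); that is, the wave packet transform with freely evolved window of the freely evolved function equals the original transform translated along the free classical flow, times the phase e^{−it|ξ|²/2}. -/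
open MeasureTheory Complex Real
open scoped InnerProductSpace ENNReal

open MeasureTheory Complex Real
open scoped InnerProductSpace ENNReal

/-- The Fourier transform `F f (ξ) = (2π)^{-n/2} ∫ f x e^{-i x·ξ} dx`. -/
noncomputable def fourierT {n : ℕ} (f : EuclideanSpace ℝ (Fin n) → ℂ)
    (ξ : EuclideanSpace ℝ (Fin n)) : ℂ :=
  (((2 * Real.pi) ^ (-(n : ℝ) / 2) : ℝ) : ℂ) *
    ∫ x, f x * Complex.exp (-(Complex.I * (⟪x, ξ⟫_ℝ : ℂ)))

/-- The inverse Fourier transform `F⁻¹ g (x) = (2π)^{-n/2} ∫ g ξ e^{i x·ξ} dξ`. -/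
noncomputable def fourierTInv {n : ℕ} (g : EuclideanSpace ℝ (Fin n) → ℂ)
    (x : EuclideanSpace ℝ (Fin n)) : ℂ :=
  (((2 * Real.pi) ^ (-(n : ℝ) / 2) : ℝ) : ℂ) *
    ∫ ξ, g ξ * Complex.exp (Complex.I * (⟪x, ξ⟫_ℝ : ℂ))

/-- The free Schrödinger propagator `e^{itΔ/2} f = F⁻¹ [ξ ↦ e^{-it|ξ|²/2} (F f)(ξ)]`. -/
noncomputable def freeProp {n : ℕ} (t : ℝ) (f : EuclideanSpace ℝ (Fin n) → ℂ) :
    EuclideanSpace ℝ (Fin n) → ℂ :=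
  fourierTInv (fun ξ => Complex.exp (-(Complex.I * (t : ℂ) * ((‖ξ‖ ^ 2 : ℝ) : ℂ) / 2)) * fourierT f ξ)

open scoped SchwartzMap FourierTransform

theorem hasTemperateGrowth_cexp_I_mul :
    (fun s : ℝ => Complex.exp (Complex.I * s)).HasTemperateGrowth := by
  refine ⟨(contDiff_const.mul Complex.ofRealCLM.contDiff).cexp, fun k => ⟨0, 1, fun s => ?_⟩⟩
  have h : ∀ k : ℕ, iteratedDeriv k (fun s : ℝ => Complex.exp (Complex.I * s)) =
      fun s : ℝ => Complex.I ^ k * Complex.exp (Complex.I * s) := by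
    intro k
    induction k with
    | zero => simp
    | succ k ih =>
      rw [iteratedDeriv_succ, ih]
      funext s
      have h1 : HasDerivAt (fun s : ℝ => Complex.I * (s : ℂ)) (Complex.I * 1) s :=
        (Complex.ofRealCLM.hasDerivAt (x := s)).const_mul Complex.I
      rw [(h1.cexp.const_mul (Complex.I ^ k)).deriv]
      ring
  rw [norm_iteratedFDeriv_eq_norm_iteratedDeriv, h]
  simp [mul_comm Complex.I, Complex.norm_exp_ofReal_mul_I]

theorem Function.HasTemperateGrowth.cexp_I_mul {E : Type*} [NormedAddCommGroup E]
    [NormedSpace ℝ E] {θ : E → ℝ} (hθ : θ.HasTemperateGrowth) :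
    (fun x => Complex.exp (Complex.I * (θ x : ℂ))).HasTemperateGrowth :=
  hasTemperateGrowth_cexp_I_mul.comp hθ

variable {n : ℕ}

/-- The symbol of the free Schrödinger propagator for Mathlib's Fourier transform. -/
noncomputable def freeSymbol (t : ℝ) (η : EuclideanSpace ℝ (Fin n)) : ℂ :=
  Complex.exp (Complex.I * ((-(t * ‖(2 * Real.pi) • η‖ ^ 2 / 2) : ℝ) : ℂ))

theorem hasTemperateGrowth_freeSymbol (t : ℝ) :
    (freeSymbol (n := n) t).HasTemperateGrowth := by
  refine Function.HasTemperateGrowth.cexp_I_mul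
    (θ := fun η => -(t * ‖(2 * Real.pi) • η‖ ^ 2 / 2)) ?_
  simp only [norm_smul, mul_pow, div_eq_mul_inv]
  fun_prop

theorem conj_freeSymbol_mul_self (t : ℝ) (η : EuclideanSpace ℝ (Fin n)) :
    (starRingEnd ℂ) (freeSymbol t η) * freeSymbol t η = 1 := by
  rw [Complex.conj_mul', freeSymbol, mul_comm, Complex.norm_exp_ofReal_mul_I]
  simp

/-- The free Schrödinger propagator on Schwartz functions. -/
noncomputable def freePropSchwartz (t : ℝ) (f : 𝓢(EuclideanSpace ℝ (Fin n), ℂ)) :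
    𝓢(EuclideanSpace ℝ (Fin n), ℂ) :=
  𝓕⁻ (SchwartzMap.smulLeftCLM ℂ (freeSymbol t) (𝓕 f))

theorem fourier_freePropSchwartz_apply (t : ℝ) (f : 𝓢(EuclideanSpace ℝ (Fin n), ℂ))
    (η : EuclideanSpace ℝ (Fin n)) :
    𝓕 (freePropSchwartz t f) η = freeSymbol t η * 𝓕 f η := by
  simp [freePropSchwartz, SchwartzMap.smulLeftCLM_apply_apply (hasTemperateGrowth_freeSymbol t)]

theorem freePropSchwartz_apply (t : ℝ) (f : 𝓢(EuclideanSpace ℝ (Fin n), ℂ))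
    (x : EuclideanSpace ℝ (Fin n)) :
    freePropSchwartz t f x =
      ∫ η, freeSymbol t η * 𝓕 f η * Complex.exp (Complex.I * (⟪x, (2 * Real.pi) • η⟫_ℝ : ℂ)) := by
  rw [freePropSchwartz, SchwartzMap.fourierInv_coe, Real.fourierInv_eq']
  refine integral_congr_ae (.of_forall fun η => ?_)
  simp only [SchwartzMap.smulLeftCLM_apply_apply (hasTemperateGrowth_freeSymbol t), smul_eq_mul,
    inner_smul_right, real_inner_comm]
  rw [mul_comm]
  congr 2
  push_cast
  ring

theorem fourierT_smul_eq_fourier (f : EuclideanSpace ℝ (Fin n) → ℂ)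
    (η : EuclideanSpace ℝ (Fin n)) :
    fourierT f ((2 * Real.pi) • η) = (((2 * Real.pi) ^ (-(n : ℝ) / 2) : ℝ) : ℂ) * 𝓕 f η := by
  rw [fourierT, Real.fourier_eq']
  congr 1
  refine integral_congr_ae (.of_forall fun x => ?_)
  simp only [smul_eq_mul, inner_smul_right]
  rw [mul_comm]
  congr 2
  push_cast
  ring

theorem freeProp_eq_freePropSchwartz (t : ℝ) (f : 𝓢(EuclideanSpace ℝ (Fin n), ℂ)) :
    freeProp t ⇑f = freePropSchwartz t f := by
  funext x
  have hscale := Measure.integral_comp_smul_of_nonneg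
    (volume : Measure (EuclideanSpace ℝ (Fin n)))
    (fun ξ => Complex.exp (-(Complex.I * (t : ℂ) * ((‖ξ‖ ^ 2 : ℝ) : ℂ) / 2)) * fourierT f ξ *
      Complex.exp (Complex.I * (⟪x, ξ⟫_ℝ : ℂ))) (2 * Real.pi) (hR := by positivity)
  have hπ : (0 : ℝ) < 2 * Real.pi := by positivity
  have hc : (2 * Real.pi) ^ (-(n : ℝ) / 2) * (2 * Real.pi) ^ (-(n : ℝ) / 2) =
      ((2 * Real.pi) ^ n)⁻¹ := by
    rw [← Real.rpow_add hπ, ← Real.rpow_natCast, ← Real.rpow_neg hπ.le]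
    congr 1
    ring
  have hc0 : (2 * Real.pi) ^ (-(n : ℝ) / 2) ≠ 0 := (Real.rpow_pos_of_pos hπ _).ne'
  have hint : (fun η : EuclideanSpace ℝ (Fin n) =>
      Complex.exp (-(Complex.I * (t : ℂ) * ((‖(2 * Real.pi) • η‖ ^ 2 : ℝ) : ℂ) / 2)) *
        fourierT f ((2 * Real.pi) • η) *
        Complex.exp (Complex.I * (⟪x, (2 * Real.pi) • η⟫_ℝ : ℂ))) =
      fun η => (((2 * Real.pi) ^ (-(n : ℝ) / 2) : ℝ) : ℂ) * (freeSymbol t η * 𝓕 f η *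
        Complex.exp (Complex.I * (⟪x, (2 * Real.pi) • η⟫_ℝ : ℂ))) := by
    funext η
    rw [fourierT_smul_eq_fourier, SchwartzMap.fourier_coe, freeSymbol]
    have : -(Complex.I * (t : ℂ) * ((‖(2 * Real.pi) • η‖ ^ 2 : ℝ) : ℂ) / 2) =
        Complex.I * ((-(t * ‖(2 * Real.pi) • η‖ ^ 2 / 2) : ℝ) : ℂ) := by
      push_cast
      ring
    rw [this]
    ring
  rw [finrank_euclideanSpace_fin, ← hc, hint, integral_const_mul,
    Complex.real_smul, Complex.ofReal_mul, mul_assoc] at hscale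
  rw [freePropSchwartz_apply, freeProp, fourierTInv]
  exact (mul_left_cancel₀ (Complex.ofReal_ne_zero.2 hc0) hscale).symm

/-- The Schwartz function `y ↦ e^{i y·ξ} ψ (y - a)`. -/
noncomputable def timeFrequencyShift (a ξ : EuclideanSpace ℝ (Fin n))
    (ψ : 𝓢(EuclideanSpace ℝ (Fin n), ℂ)) : 𝓢(EuclideanSpace ℝ (Fin n), ℂ) :=
  SchwartzMap.smulLeftCLM ℂ (fun y => Complex.exp (Complex.I * (⟪y, ξ⟫_ℝ : ℂ)))
    (ψ.compSubConstCLM ℂ a)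

theorem timeFrequencyShift_apply (a ξ : EuclideanSpace ℝ (Fin n))
    (ψ : 𝓢(EuclideanSpace ℝ (Fin n), ℂ)) (y : EuclideanSpace ℝ (Fin n)) :
    timeFrequencyShift a ξ ψ y = Complex.exp (Complex.I * (⟪y, ξ⟫_ℝ : ℂ)) * ψ (y - a) := by
  rw [timeFrequencyShift, SchwartzMap.smulLeftCLM_apply_apply
    (Function.HasTemperateGrowth.cexp_I_mul (by fun_prop))]
  rfl

theorem fourier_timeFrequencyShift_add (a κ η : EuclideanSpace ℝ (Fin n))
    (ψ : 𝓢(EuclideanSpace ℝ (Fin n), ℂ)) :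
    𝓕 (timeFrequencyShift a ((2 * Real.pi) • κ) ψ) (η + κ) =
      Complex.exp (-(Complex.I * (⟪a, (2 * Real.pi) • η⟫_ℝ : ℂ))) * 𝓕 ψ η := by
  simp only [SchwartzMap.fourier_coe, Real.fourier_eq']
  rw [← integral_add_right_eq_self _ a, ← integral_const_mul]
  refine integral_congr_ae (.of_forall fun y => ?_)
  simp only [timeFrequencyShift_apply, add_sub_cancel_right, smul_eq_mul, ← mul_assoc,
    ← Complex.exp_add]
  congr 2
  simp only [inner_add_left, inner_add_right, inner_smul_right]
  push_cast
  ring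

theorem freeSymbol_add (t : ℝ) (η κ : EuclideanSpace ℝ (Fin n)) :
    freeSymbol t (η + κ) = freeSymbol t κ * freeSymbol t η *
      Complex.exp (-(Complex.I * (⟪t • (2 * Real.pi) • κ, (2 * Real.pi) • η⟫_ℝ : ℂ))) := by
  simp only [freeSymbol, ← Complex.exp_add, smul_add, norm_add_sq_real, inner_smul_left,
    inner_smul_right, real_inner_comm η κ]
  congr 1
  simp
  ring

/-- Galilean covariance of the free Schrödinger propagator. -/
theorem freePropSchwartz_timeFrequencyShift (t : ℝ) (a κ : EuclideanSpace ℝ (Fin n))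
    (ψ : 𝓢(EuclideanSpace ℝ (Fin n), ℂ)) (y : EuclideanSpace ℝ (Fin n)) :
    freePropSchwartz t (timeFrequencyShift a ((2 * Real.pi) • κ) ψ) y =
      freeSymbol t κ * timeFrequencyShift (a + t • (2 * Real.pi) • κ) ((2 * Real.pi) • κ)
        (freePropSchwartz t ψ) y := by
  rw [timeFrequencyShift_apply, freePropSchwartz_apply, freePropSchwartz_apply,
    ← integral_add_right_eq_self _ κ, ← integral_const_mul, ← integral_const_mul]
  refine integral_congr_ae (.of_forall fun η => ?_)
  simp only [fourier_timeFrequencyShift_add, freeSymbol_add]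
  have h : Complex.exp (-(Complex.I * (⟪t • (2 * Real.pi) • κ, (2 * Real.pi) • η⟫_ℝ : ℂ))) *
      Complex.exp (-(Complex.I * (⟪a, (2 * Real.pi) • η⟫_ℝ : ℂ))) *
      Complex.exp (Complex.I * (⟪y, (2 * Real.pi) • (η + κ)⟫_ℝ : ℂ)) =
      Complex.exp (Complex.I * (⟪y, (2 * Real.pi) • κ⟫_ℝ : ℂ)) *
      Complex.exp (Complex.I *
        (⟪y - (a + t • (2 * Real.pi) • κ), (2 * Real.pi) • η⟫_ℝ : ℂ)) := by
    simp only [← Complex.exp_add, smul_add, inner_add_left, inner_add_right, inner_sub_left]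
    congr 1
    push_cast
    ring
  linear_combination (freeSymbol t κ * freeSymbol t η * 𝓕 ψ η) * h

theorem integral_conj_freePropSchwartz_mul (t : ℝ) (f g : 𝓢(EuclideanSpace ℝ (Fin n), ℂ)) :
    ∫ y, (starRingEnd ℂ) (freePropSchwartz t g y) * freePropSchwartz t f y =
      ∫ y, (starRingEnd ℂ) (g y) * f y := by
  have key (u v : 𝓢(EuclideanSpace ℝ (Fin n), ℂ)) :
      ∫ y, (starRingEnd ℂ) (u y) * v y = ∫ η, (starRingEnd ℂ) (𝓕 u η) * 𝓕 v η := by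
    simpa [mul_comm] using (SchwartzMap.integral_inner_fourier_fourier u v).symm
  rw [key (freePropSchwartz t g), key g]
  refine integral_congr_ae (.of_forall fun η => ?_)
  simp only [fourier_freePropSchwartz_apply, map_mul]
  linear_combination ((starRingEnd ℂ) (𝓕 g η) * 𝓕 f η) * conj_freeSymbol_mul_self t η

theorem wavePacket_eq_integral_timeFrequencyShift (f ψ : 𝓢(EuclideanSpace ℝ (Fin n), ℂ))
    (x ξ : EuclideanSpace ℝ (Fin n)) :
    wavePacket ψ f x ξ = ∫ y, (starRingEnd ℂ) (timeFrequencyShift x ξ ψ y) * f y := by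
  refine integral_congr_ae (.of_forall fun y => ?_)
  simp only [timeFrequencyShift_apply, map_mul, ← Complex.exp_conj, Complex.conj_I,
    Complex.conj_ofReal, neg_mul]
  ring

/-- The wave packet transform with freely evolved window of the freely
evolved function equals the original transform translated along the free classical flow,
times the phase `e^{-it|ξ|²/2}`:
`W_{e^{itΔ/2}ψ}[e^{itΔ/2} f](x,ξ) = e^{-it|ξ|²/2} W_ψ f (x - tξ, ξ)`. -/
theorem wavePacket_freeProp (n : ℕ) (hn : 1 ≤ n) (t : ℝ)
    (f ψ : SchwartzMap (EuclideanSpace ℝ (Fin n)) ℂ) (hψ : ψ ≠ 0) :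
    ∀ x ξ : EuclideanSpace ℝ (Fin n),
      wavePacket (freeProp t ⇑ψ) (freeProp t ⇑f) x ξ
        = Complex.exp (-(Complex.I * (t : ℂ) * ((‖ξ‖ ^ 2 : ℝ) : ℂ) / 2)) *
            wavePacket (⇑ψ) (⇑f) (x - t • ξ) ξ := by
  intro x ξ
  obtain ⟨κ, rfl⟩ : ∃ κ, ξ = (2 * Real.pi) • κ :=
    ⟨(2 * Real.pi)⁻¹ • ξ, (smul_inv_smul₀ (by positivity) ξ).symm⟩
  have hphase : Complex.exp (-(Complex.I * (t : ℂ) *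
      ((‖(2 * Real.pi) • κ‖ ^ 2 : ℝ) : ℂ) / 2)) = freeSymbol t κ := by
    rw [freeSymbol]
    congr 1
    push_cast
    ring
  rw [freeProp_eq_freePropSchwartz, freeProp_eq_freePropSchwartz, hphase,
    wavePacket_eq_integral_timeFrequencyShift, wavePacket_eq_integral_timeFrequencyShift,
    ← integral_conj_freePropSchwartz_mul t f (timeFrequencyShift _ _ ψ), ← integral_const_mul]
  refine integral_congr_ae (.of_forall fun y => ?_)
  simp only [freePropSchwartz_timeFrequencyShift, sub_add_cancel, map_mul]
  linear_combination -((starRingEnd ℂ) (timeFrequencyShift x ((2 * Real.pi) • κ)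
    (freePropSchwartz t ψ) y) * freePropSchwartz t f y) * conj_freeSymbol_mul_self t κ
end

section
/- Let n ≥ 1, p, q ∈ ℕ with p + q ≥ 2, and 0 < b < 1. Define g_{λ,t}(x) = λ^{nb/2} (1 + i λ^{2b} t)^{−n/2} exp( − λ^{2b} |x|² / (2(1 + i λ^{2b} t)) ) (principal branch). Then there exists C > 0, depending only on n, p, q, such that for all λ ≥ 1 and all t ∈ ℝ, | ∫_{ℝⁿ} g_{λ,t}(x)^{q+1} conj(g_{λ,t}(x))^{p} dx | ≥ C λ^{nb(p+q−1)/2} (1 + λ^{4b} t²)^{−n(p+q)/4}. (The left-hand side is |(g_{λ,t}, 𝒩[g_{λ,t}])| with 𝒩[u] = u^p ū^q and inner product (f,h) = ∫ f conj(h).) -/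
open MeasureTheory Complex Real
open scoped InnerProductSpace ENNReal

/-- The free Schrödinger evolution `e^{itΔ/2}` at time `t` of the scaled Gaussian wave packet
`λ^{nb/2} e^{-λ^{2b}|x|²/2}`, given by the explicit formula
`g_{λ,t}(x) = λ^{nb/2} (1 + iλ^{2b}t)^{-n/2} exp(-λ^{2b}|x|²/(2(1+iλ^{2b}t)))`,
with the principal branch of the complex power. -/
noncomputable def gaussEvol (n : ℕ) (b l t : ℝ) (x : EuclideanSpace ℝ (Fin n)) : ℂ :=
  ((l ^ ((n : ℝ) * b / 2) : ℝ) : ℂ) *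
    ((1 : ℂ) + Complex.I * ((l ^ (2 * b) : ℝ) : ℂ) * (t : ℂ)) ^ (-(n : ℂ) / 2) *
    Complex.exp (-(((l ^ (2 * b) : ℝ) : ℂ) * ((‖x‖ ^ 2 : ℝ) : ℂ)) /
      (2 * ((1 : ℂ) + Complex.I * ((l ^ (2 * b) : ℝ) : ℂ) * (t : ℂ))))

/-- The coefficient of `-‖x‖²` in the exponent of `g^{q+1} conj(g)^p`, where `a = λ^{2b}` and
`z = 1 + iλ^{2b}t`. -/
noncomputable def gaussRate (p q : ℕ) (a : ℝ) (z : ℂ) : ℂ :=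
  (a : ℂ) / 2 * (((q : ℂ) + 1) / z + (p : ℂ) / (starRingEnd ℂ) z)

lemma gaussRate_re_pos (p q : ℕ) {a : ℝ} (ha : 0 < a) {z : ℂ} (hz : 0 < z.re) :
    0 < (gaussRate p q a z).re := by
  have hz0 : z ≠ 0 := by rintro rfl; simp at hz
  have hN : 0 < Complex.normSq z := Complex.normSq_pos.2 hz0
  have key : gaussRate p q a z = ((a / 2 : ℝ) : ℂ) *
      ((((q : ℝ) + 1 : ℝ) : ℂ) * z⁻¹ + ((p : ℝ) : ℂ) * ((starRingEnd ℂ) z)⁻¹) := by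
    rw [gaussRate]; push_cast; ring
  rw [key, Complex.re_ofReal_mul, Complex.add_re, Complex.re_ofReal_mul, Complex.re_ofReal_mul,
    Complex.inv_re, Complex.inv_re, Complex.normSq_conj, Complex.conj_re]
  positivity

lemma norm_gaussRate_le (p q : ℕ) {a : ℝ} (ha : 0 < a) (z : ℂ) :
    ‖gaussRate p q a z‖ ≤ a * ((p : ℝ) + q + 1) / (2 * ‖z‖) := by
  have h : ‖((q : ℂ) + 1) / z + (p : ℂ) / (starRingEnd ℂ) z‖ ≤
      ((q : ℝ) + 1) / ‖z‖ + p / ‖z‖ := by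
    refine (norm_add_le _ _).trans (le_of_eq ?_)
    have hq : ‖(q : ℂ) + 1‖ = (q : ℝ) + 1 := by exact_mod_cast Complex.norm_natCast (q + 1)
    rw [norm_div, norm_div, RCLike.norm_conj, hq, Complex.norm_natCast]
  have ha' : ‖(a : ℂ) / 2‖ = a / 2 := by
    rw [norm_div, Complex.norm_real, Real.norm_of_nonneg ha.le]; simp
  rw [gaussRate, norm_mul, ha']
  calc a / 2 * _ ≤ a / 2 * (((q : ℝ) + 1) / ‖z‖ + p / ‖z‖) := by gcongr
    _ = _ := by rw [← add_div, div_mul_div_comm]; ring_nf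

lemma gaussEvol_pow_mul_conj_pow (n p q : ℕ) (b l t : ℝ) (x : EuclideanSpace ℝ (Fin n)) :
    gaussEvol n b l t x ^ (q + 1) * (starRingEnd ℂ) (gaussEvol n b l t x) ^ p =
      (((l ^ ((n : ℝ) * b / 2) : ℝ) : ℂ) *
        ((1 : ℂ) + Complex.I * ((l ^ (2 * b) : ℝ) : ℂ) * (t : ℂ)) ^ (-(n : ℂ) / 2)) ^ (q + 1) *
      (starRingEnd ℂ) (((l ^ ((n : ℝ) * b / 2) : ℝ) : ℂ) *
        ((1 : ℂ) + Complex.I * ((l ^ (2 * b) : ℝ) : ℂ) * (t : ℂ)) ^ (-(n : ℂ) / 2)) ^ p *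
      Complex.exp (-gaussRate p q (l ^ (2 * b))
        ((1 : ℂ) + Complex.I * ((l ^ (2 * b) : ℝ) : ℂ) * (t : ℂ)) * (‖x‖ : ℂ) ^ 2) := by
  rw [gaussEvol]
  generalize ((l ^ ((n : ℝ) * b / 2) : ℝ) : ℂ) *
    ((1 : ℂ) + Complex.I * ((l ^ (2 * b) : ℝ) : ℂ) * (t : ℂ)) ^ (-(n : ℂ) / 2) = A
  set z := (1 : ℂ) + Complex.I * ((l ^ (2 * b) : ℝ) : ℂ) * (t : ℂ)
  set a := l ^ (2 * b)
  rw [map_mul, mul_pow, mul_pow, ← Complex.exp_conj, ← Complex.exp_nat_mul, ← Complex.exp_nat_mul,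
    mul_mul_mul_comm, ← Complex.exp_add]
  congr 2
  simp only [gaussRate, map_div₀, map_neg, map_mul, Complex.conj_ofReal, Complex.conj_ofNat]
  push_cast
  simp only [div_eq_mul_inv, mul_inv]
  ring

lemma norm_integral_cexp_neg_mul_sq_norm_ge {V : Type*} [NormedAddCommGroup V]
    [InnerProductSpace ℝ V] [FiniteDimensional ℝ V] [MeasurableSpace V] [BorelSpace V]
    {β : ℂ} (hβ : 0 < β.re) {r : ℝ} (hr : ‖β‖ ≤ r) :
    (π / r) ^ ((Module.finrank ℝ V : ℝ) / 2) ≤ ‖∫ v : V, Complex.exp (-β * (‖v‖ : ℂ) ^ 2)‖ := by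
  have hβ0 : 0 < ‖β‖ := hβ.trans_le (Complex.re_le_norm β)
  have hcast : (Module.finrank ℝ V / 2 : ℂ) = (((Module.finrank ℝ V : ℝ) / 2 : ℝ) : ℂ) := by
    push_cast; rfl
  rw [GaussianFourier.integral_cexp_neg_mul_sq_norm hβ, hcast, Complex.norm_cpow_real, norm_div,
    Complex.norm_real, Real.norm_of_nonneg Real.pi_pos.le]
  have : 0 < r := hβ0.trans_le hr
  gcongr

/-- For the evolved Gaussian wave packet `g_{λ,t}` and the nonlinearity
`𝒩[u] = u^p ū^q` with `p + q ≥ 2`, there is `C > 0` depending only on `n, p, q` such that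
`|(g_{λ,t}, 𝒩[g_{λ,t}])| = |∫ g^{q+1} conj(g)^p| ≥ C λ^{nb(p+q-1)/2} (1+λ^{4b}t²)^{-n(p+q)/4}`
for all `0 < b < 1`, `λ ≥ 1` and `t ∈ ℝ`. -/
theorem gaussEvol_inner_nonlinearity_lower (n : ℕ) (hn : 1 ≤ n) (p q : ℕ) (hpq : 2 ≤ p + q) :
    ∃ C > (0 : ℝ), ∀ b : ℝ, 0 < b → b < 1 → ∀ l : ℝ, 1 ≤ l → ∀ t : ℝ,
      C * l ^ ((n : ℝ) * b * ((p : ℝ) + (q : ℝ) - 1) / 2) *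
          (1 + l ^ (4 * b) * t ^ 2) ^ (-((n : ℝ) * ((p : ℝ) + (q : ℝ))) / 4)
        ≤ ‖∫ x, gaussEvol n b l t x ^ (q + 1) * (starRingEnd ℂ) (gaussEvol n b l t x) ^ p‖ := by
  refine ⟨(2 * π / ((p : ℝ) + q + 1)) ^ ((n : ℝ) / 2), by positivity, ?_⟩
  intro b _ _ l hl t
  have hl0 : 0 < l := by linarith
  have ha : 0 < l ^ (2 * b) := by positivity
  have hzre : 0 < ((1 : ℂ) + Complex.I * ((l ^ (2 * b) : ℝ) : ℂ) * (t : ℂ)).re := by simp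
  have hcast : -(n : ℂ) / 2 = ((-(n : ℝ) / 2 : ℝ) : ℂ) := by push_cast; rfl
  have hznorm : 1 + l ^ (4 * b) * t ^ 2 =
      ‖(1 : ℂ) + Complex.I * ((l ^ (2 * b) : ℝ) : ℂ) * (t : ℂ)‖ ^ (2 : ℝ) := by
    have : l ^ (4 * b) = l ^ (2 * b) * l ^ (2 * b) := by
      rw [← Real.rpow_add hl0]; ring_nf
    rw [Real.rpow_two, Complex.sq_norm, Complex.normSq_apply, this]
    simp
    ring
  simp_rw [gaussEvol_pow_mul_conj_pow]
  rw [integral_const_mul, hznorm, norm_mul, norm_mul, norm_pow, norm_pow, RCLike.norm_conj,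
    ← pow_add, norm_mul, hcast, Complex.norm_cpow_real, Complex.norm_real,
    Real.norm_of_nonneg (by positivity)]
  have hI := norm_integral_cexp_neg_mul_sq_norm_ge (V := EuclideanSpace ℝ (Fin n))
    (gaussRate_re_pos p q ha hzre) (norm_gaussRate_le p q ha _)
  have hw : 0 < ‖(1 : ℂ) + Complex.I * ((l ^ (2 * b) : ℝ) : ℂ) * (t : ℂ)‖ :=
    hzre.trans_le (Complex.re_le_norm _)
  rw [finrank_euclideanSpace, Fintype.card_fin] at hI
  refine le_trans (le_of_eq ?_) (mul_le_mul_of_nonneg_left hI (by positivity))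
  set w := ‖(1 : ℂ) + Complex.I * ((l ^ (2 * b) : ℝ) : ℂ) * (t : ℂ)‖
  have hbase : π / (l ^ (2 * b) * ((p : ℝ) + q + 1) / (2 * w)) =
      2 * π / ((p : ℝ) + q + 1) * l ^ (-(2 * b)) * w := by
    rw [Real.rpow_neg hl0.le]
    field_simp
  rw [hbase, Real.mul_rpow (by positivity) hw.le, Real.mul_rpow (by positivity) (by positivity),
    mul_pow, ← Real.rpow_mul hl0.le, ← Real.rpow_mul hw.le, ← Real.rpow_mul_natCast hl0.le,
    ← Real.rpow_mul_natCast hw.le]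
  have e1 : l ^ ((n : ℝ) * b * ((p : ℝ) + (q : ℝ) - 1) / 2) =
      l ^ ((n : ℝ) * b / 2 * ((q + 1 + p : ℕ) : ℝ)) * l ^ (-(2 * b) * ((n : ℝ) / 2)) := by
    rw [← Real.rpow_add hl0]; congr 1; push_cast; ring
  have e2 : w ^ ((2 : ℝ) * (-((n : ℝ) * ((p : ℝ) + (q : ℝ))) / 4)) =
      w ^ (-(n : ℝ) / 2 * ((q + 1 + p : ℕ) : ℝ)) * w ^ ((n : ℝ) / 2) := by
    rw [← Real.rpow_add hw]; congr 1; push_cast; ring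
  rw [e1, e2]
  ring
end

section
/- Let n ≥ 1, p, q ∈ ℕ with p + q ≥ 2, 0 < b < 1 and t₀ > 0. Define g_{λ,t}(x) = λ^{nb/2} (1 + i λ^{2b} t)^{−n/2} exp( − λ^{2b} |x|² / (2(1 + i λ^{2b} t)) ) (principal branch). Then there exists C > 0, depending only on n, p, q, t₀, such that for all λ ≥ 1: (a) if 0 ≤ |t| ≤ λ^{−(p+q)nb} then | ∫_{ℝⁿ} g_{λ,t}(x)^{q+1} conj(g_{λ,t}(x))^{p} dx | ≥ C λ^{nb(p+q−1)/2}; (b) if λ^{−(p+q)nb} ≤ |t| ≤ t₀ then | ∫_{ℝⁿ} g_{λ,t}(x)^{q+1} conj(g_{λ,t}(x))^{p} dx | ≥ C λ^{−nb(p+q+1)/2}. -/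
open MeasureTheory Complex Real
open scoped InnerProductSpace ENNReal

/-- The complex Gaussian exponent `a ((q+1)/z + p/z̄)` has positive real part when `z` does. -/
theorem re_gaussExponent_pos (p q : ℕ) {a : ℝ} (ha : 0 < a) {z : ℂ} (hz : 0 < z.re) :
    0 < ((a : ℂ) / 2 * ((q + 1) / z + p / (starRingEnd ℂ) z)).re := by
  have hz0 : z ≠ 0 := by rintro rfl; simp at hz
  have hinv : 0 < (z⁻¹).re := by
    rw [Complex.inv_re]
    exact div_pos hz (Complex.normSq_pos.2 hz0)
  have h : (a : ℂ) / 2 * ((q + 1) / z + p / (starRingEnd ℂ) z) = ((a / 2 : ℝ) : ℂ) *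
      (((q + 1 : ℝ) : ℂ) * z⁻¹ + ((p : ℝ) : ℂ) * (starRingEnd ℂ) z⁻¹) := by
    rw [map_inv₀]; push_cast; ring
  rw [h, Complex.re_ofReal_mul, Complex.add_re, Complex.re_ofReal_mul, Complex.re_ofReal_mul,
    Complex.conj_re]
  positivity

/-- The exact size of `∫ g^{q+1} conj(g)^p`, in terms of `z = 1 + iλ^{2b}t`. -/
theorem norm_integral_gaussEvol (n p q : ℕ) (b l t : ℝ) (hl : 0 < l) (z : ℂ)
    (hz : z = 1 + Complex.I * ((l ^ (2 * b) : ℝ) : ℂ) * (t : ℂ)) :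
    ‖∫ x, gaussEvol n b l t x ^ (q + 1) * (starRingEnd ℂ) (gaussEvol n b l t x) ^ p‖ =
      (l ^ ((n : ℝ) * b / 2) * ‖z‖ ^ (-(n : ℝ) / 2)) ^ (p + q + 1) *
        ‖(π : ℂ) / (((l ^ (2 * b) : ℝ) : ℂ) / 2 * ((q + 1) / z + p / (starRingEnd ℂ) z))‖ ^
          ((n : ℝ) / 2) := by
  have hA : 0 < l ^ (2 * b) := Real.rpow_pos_of_pos hl _
  have hzre : z.re = 1 := by simp [hz, Complex.mul_re, Complex.mul_im]
  have hz0 : z ≠ 0 := by rintro h; simp [h] at hzre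
  set A : ℝ := l ^ (2 * b)
  set B : ℂ := (A : ℂ) / 2 * ((q + 1) / z + p / (starRingEnd ℂ) z) with hB
  have hBre : 0 < B.re := re_gaussExponent_pos p q hA (hzre ▸ one_pos)
  set c : ℂ := ((l ^ ((n : ℝ) * b / 2) : ℝ) : ℂ) * z ^ (-(n : ℂ) / 2) with hc
  have hg (x : EuclideanSpace ℝ (Fin n)) :
      gaussEvol n b l t x ^ (q + 1) * (starRingEnd ℂ) (gaussEvol n b l t x) ^ p =
        (c ^ (q + 1) * (starRingEnd ℂ) c ^ p) * Complex.exp (-B * ‖x‖ ^ 2) := by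
    have hx : gaussEvol n b l t x = c * Complex.exp (-(A * ‖x‖ ^ 2) / (2 * z)) := by
      rw [gaussEvol, ← hz, hc]; push_cast; rfl
    have hcz : (starRingEnd ℂ) z ≠ 0 := by simpa using hz0
    clear_value c
    rw [hx, map_mul, mul_pow, mul_pow, ← Complex.exp_conj, ← Complex.exp_nat_mul,
      ← Complex.exp_nat_mul, mul_mul_mul_comm, ← Complex.exp_add]
    congr 2
    simp only [hB, map_div₀, map_mul, map_neg, map_pow, Complex.conj_ofReal, map_ofNat]
    push_cast
    field_simp
    ring
  have hcn : ‖c‖ = l ^ ((n : ℝ) * b / 2) * ‖z‖ ^ (-(n : ℝ) / 2) := by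
    have h : (-(n : ℂ) / 2) = ((-(n : ℝ) / 2 : ℝ) : ℂ) := by push_cast; rfl
    rw [hc, norm_mul, h, Complex.norm_cpow_real, Complex.norm_of_nonneg (by positivity)]
  simp_rw [hg]
  rw [integral_const_mul, GaussianFourier.integral_cexp_neg_mul_sq_norm hBre,
    finrank_euclideanSpace_fin]
  have h : ((n : ℂ) / 2) = ((n / 2 : ℝ) : ℂ) := by push_cast; rfl
  rw [h, norm_mul, Complex.norm_cpow_real, norm_mul, norm_pow, norm_pow, RCLike.norm_conj, hcn]
  ring

/-- Lower bound with the dispersive factor `‖1 + iλ^{2b}t‖` replaced by any upper bound `R`. -/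
theorem norm_integral_gaussEvol_ge (n p q : ℕ) (b l t R : ℝ) (hl : 0 < l)
    (hR : 1 + l ^ (2 * b) * |t| ≤ R) :
    (2 * π / ((p : ℝ) + q + 1)) ^ ((n : ℝ) / 2) * R ^ (-((n : ℝ) * (p + q) / 2)) *
        l ^ ((n : ℝ) * b * ((p : ℝ) + q - 1) / 2) ≤
      ‖∫ x, gaussEvol n b l t x ^ (q + 1) * (starRingEnd ℂ) (gaussEvol n b l t x) ^ p‖ := by
  obtain ⟨z, hz⟩ : ∃ z : ℂ, z = 1 + Complex.I * ((l ^ (2 * b) : ℝ) : ℂ) * (t : ℂ) := ⟨_, rfl⟩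
  rw [norm_integral_gaussEvol n p q b l t hl z hz]
  have hA : 0 < l ^ (2 * b) := Real.rpow_pos_of_pos hl _
  have hzre : z.re = 1 := by simp [hz, Complex.mul_re, Complex.mul_im]
  have hz0 : z ≠ 0 := by rintro h; simp [h] at hzre
  have hr : 0 < ‖z‖ := norm_pos_iff.2 hz0
  have hzR : ‖z‖ ≤ R := by
    refine le_trans ?_ hR
    rw [hz]
    refine (norm_add_le _ _).trans ?_
    simp only [norm_mul, norm_one, Complex.norm_I, one_mul, Complex.norm_real, Real.norm_eq_abs]
    rw [abs_of_pos hA]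
  have hB0 : ((l ^ (2 * b) : ℝ) : ℂ) / 2 * ((q + 1) / z + p / (starRingEnd ℂ) z) ≠ 0 := by
    intro h
    have := re_gaussExponent_pos p q hA (hzre ▸ one_pos : 0 < z.re)
    simp [h] at this
  have hB : ‖((l ^ (2 * b) : ℝ) : ℂ) / 2 * ((q + 1) / z + p / (starRingEnd ℂ) z)‖ ≤
      l ^ (2 * b) / 2 * (((p : ℝ) + q + 1) / ‖z‖) := by
    rw [norm_mul, norm_div, Complex.norm_of_nonneg hA.le, Complex.norm_ofNat]
    gcongr
    refine (norm_add_le _ _).trans (le_of_eq ?_)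
    have h : ‖(q + 1 : ℂ)‖ = q + 1 := by exact_mod_cast Complex.norm_natCast (q + 1)
    rw [norm_div, norm_div, RCLike.norm_conj, h, Complex.norm_natCast]
    ring
  have hquot : 2 * π / ((p : ℝ) + q + 1) * ‖z‖ * l ^ (-(2 * b)) ≤
      ‖(π : ℂ) / (((l ^ (2 * b) : ℝ) : ℂ) / 2 * ((q + 1) / z + p / (starRingEnd ℂ) z))‖ := by
    rw [norm_div, Complex.norm_of_nonneg Real.pi_pos.le]
    refine le_trans (le_of_eq ?_) (div_le_div_of_nonneg_left Real.pi_pos.le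
      (norm_pos_iff.2 hB0) hB)
    rw [Real.rpow_neg hl.le]
    field_simp
  calc
    _ ≤ (2 * π / ((p : ℝ) + q + 1)) ^ ((n : ℝ) / 2) * ‖z‖ ^ (-((n : ℝ) * (p + q) / 2)) *
        l ^ ((n : ℝ) * b * ((p : ℝ) + q - 1) / 2) := by
      gcongr ?_ * ?_ * ?_
      exact Real.rpow_le_rpow_of_nonpos hr hzR (neg_nonpos.2 (by positivity))
    _ = (l ^ ((n : ℝ) * b / 2) * ‖z‖ ^ (-(n : ℝ) / 2)) ^ (p + q + 1) *
        (2 * π / ((p : ℝ) + q + 1) * ‖z‖ * l ^ (-(2 * b))) ^ ((n : ℝ) / 2) := by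
      rw [Real.mul_rpow (by positivity) (by positivity), Real.mul_rpow (by positivity) hr.le,
        mul_pow, ← Real.rpow_mul_natCast hl.le, ← Real.rpow_mul_natCast hr.le,
        ← Real.rpow_mul hl.le]
      have h1 : l ^ ((n : ℝ) * b * ((p : ℝ) + q - 1) / 2) =
          l ^ ((n : ℝ) * b / 2 * (p + q + 1 : ℕ)) * l ^ (-(2 * b) * ((n : ℝ) / 2)) := by
        rw [← Real.rpow_add hl]; congr 1; push_cast; ring
      have h2 : ‖z‖ ^ (-((n : ℝ) * (p + q) / 2)) =
          ‖z‖ ^ (-(n : ℝ) / 2 * (p + q + 1 : ℕ)) * ‖z‖ ^ ((n : ℝ) / 2) := by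
        rw [← Real.rpow_add hr]; congr 1; push_cast; ring
      rw [h1, h2]
      ring
    _ ≤ _ := by gcongr

/-- For the evolved Gaussian wave packet `g_{λ,t}` and the nonlinearity
`𝒩[u] = u^p ū^q` with `p + q ≥ 2`, and for `t₀ > 0`, there is `C > 0` depending only on
`n, p, q, t₀` such that for all `0 < b < 1` and `λ ≥ 1`:
(a) if `|t| ≤ λ^{-(p+q)nb}` then `|∫ g^{q+1} conj(g)^p| ≥ C λ^{nb(p+q-1)/2}`;
(b) if `λ^{-(p+q)nb} ≤ |t| ≤ t₀` then `|∫ g^{q+1} conj(g)^p| ≥ C λ^{-nb(p+q+1)/2}`. -/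
theorem gaussEvol_inner_nonlinearity_lower_cases (n : ℕ) (hn : 1 ≤ n) (p q : ℕ)
    (hpq : 2 ≤ p + q) (t₀ : ℝ) (ht₀ : 0 < t₀) :
    ∃ C > (0 : ℝ), ∀ b : ℝ, 0 < b → b < 1 → ∀ l : ℝ, 1 ≤ l → ∀ t : ℝ,
      (|t| ≤ l ^ (-(((p : ℝ) + (q : ℝ)) * (n : ℝ) * b)) →
        C * l ^ ((n : ℝ) * b * ((p : ℝ) + (q : ℝ) - 1) / 2)
          ≤ ‖∫ x, gaussEvol n b l t x ^ (q + 1) * (starRingEnd ℂ) (gaussEvol n b l t x) ^ p‖) ∧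
      (l ^ (-(((p : ℝ) + (q : ℝ)) * (n : ℝ) * b)) ≤ |t| → |t| ≤ t₀ →
        C * l ^ (-((n : ℝ) * b * ((p : ℝ) + (q : ℝ) + 1) / 2))
          ≤ ‖∫ x, gaussEvol n b l t x ^ (q + 1) * (starRingEnd ℂ) (gaussEvol n b l t x) ^ p‖) := by
  refine ⟨(2 * π / ((p : ℝ) + q + 1)) ^ ((n : ℝ) / 2) * (2 + t₀) ^ (-((n : ℝ) * (p + q) / 2)),
    by positivity, fun b hb _ l hl t => ⟨fun ht => ?_, fun _ ht => ?_⟩⟩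
  · have hl0 : 0 < l := one_pos.trans_le hl
    refine norm_integral_gaussEvol_ge n p q b l t _ hl0 ?_
    have h : l ^ (2 * b) * |t| ≤ 1 := by
      refine (mul_le_mul_of_nonneg_left ht (by positivity)).trans ?_
      rw [← Real.rpow_add hl0]
      refine Real.rpow_le_one_of_one_le_of_nonpos hl ?_
      have hpq' : (2 : ℝ) ≤ p + q := by exact_mod_cast hpq
      have hn' : (1 : ℝ) ≤ n := by exact_mod_cast hn
      have : (2 : ℝ) ≤ (p + q) * n := by nlinarith
      nlinarith
    linarith
  · have hl0 : 0 < l := one_pos.trans_le hl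
    have hA : 1 ≤ l ^ (2 * b) := Real.one_le_rpow hl (by positivity)
    refine le_trans (le_of_eq ?_)
      (norm_integral_gaussEvol_ge n p q b l t ((2 + t₀) * l ^ (2 * b)) hl0 ?_)
    · have h : l ^ (-((n : ℝ) * b * ((p : ℝ) + q + 1) / 2)) =
          l ^ (2 * b * (-((n : ℝ) * (p + q) / 2))) *
            l ^ ((n : ℝ) * b * ((p : ℝ) + q - 1) / 2) := by
        rw [← Real.rpow_add hl0]; congr 1; ring
      rw [h, Real.mul_rpow (by positivity) (by positivity), ← Real.rpow_mul hl0.le]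
      ring
    · have : l ^ (2 * b) * |t| ≤ l ^ (2 * b) * t₀ := by gcongr
      nlinarith
end

section
/- Let n ≥ 1, 0 < b < 1 and t₀ > 0. Define g_{λ,t}(x) = λ^{nb/2} (1 + i λ^{2b} t)^{−n/2} exp( − λ^{2b} |x|² / (2(1 + i λ^{2b} t)) ) (principal branch). Then there exists C > 0, depending only on n and t₀, such that for all λ ≥ 1: (a) if 0 ≤ |t| ≤ λ^{−2nb} then | ∫_{ℝⁿ} g_{λ,t}(x) conj(g_{λ,t}(x))² dx | ≥ C λ^{nb/2}; (b) if λ^{−2nb} ≤ |t| ≤ t₀ then | ∫_{ℝⁿ} g_{λ,t}(x) conj(g_{λ,t}(x))² dx | ≥ C λ^{−3nb/2}. -/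
open MeasureTheory Complex Real
open scoped InnerProductSpace ENNReal

theorem gaussEvol_mul_conj_sq (n : ℕ) (b l t : ℝ) (x : EuclideanSpace ℝ (Fin n)) :
    gaussEvol n b l t x * (starRingEnd ℂ) (gaussEvol n b l t x) ^ 2 =
      (((l ^ ((n : ℝ) * b / 2) : ℝ) : ℂ) ^ 3 *
        (1 + I * ((l ^ (2 * b) : ℝ) : ℂ) * (t : ℂ)) ^ (-(n : ℂ) / 2) *
        (starRingEnd ℂ) ((1 + I * ((l ^ (2 * b) : ℝ) : ℂ) * (t : ℂ)) ^ (-(n : ℂ) / 2)) ^ 2) *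
      cexp (-(((l ^ (2 * b) : ℝ) : ℂ) * (3 + I * ((l ^ (2 * b) * t : ℝ) : ℂ)) /
        (2 * ((1 + (l ^ (2 * b) * t) ^ 2 : ℝ) : ℂ))) * (‖x‖ : ℂ) ^ 2) := by
  have hexp : ∀ A B : ℂ, cexp A * cexp B ^ 2 = cexp (A + 2 * B) := fun A B => by
    rw [Complex.exp_add, ← Complex.exp_nat_mul B 2]; norm_num
  unfold gaussEvol
  generalize hs : l ^ (2 * b) = s
  generalize l ^ ((n : ℝ) * b / 2) = A
  have h1 : (1 : ℂ) + I * s * t ≠ 0 := fun h => by simpa using congrArg Complex.re h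
  have h2 : (1 : ℂ) - I * s * t ≠ 0 := fun h => by simpa using congrArg Complex.re h
  have h3 : (1 : ℂ) + (s * t) ^ 2 = (1 + I * s * t) * (1 - I * s * t) := by
    linear_combination ((s : ℂ) ^ 2 * t ^ 2) * I_sq
  rw [map_mul, map_mul, ← Complex.exp_conj, conj_ofReal]
  have hE : cexp (-((s : ℂ) * (3 + I * ((s * t : ℝ) : ℂ)) /
        (2 * ((1 + (s * t) ^ 2 : ℝ) : ℂ))) * (‖x‖ : ℂ) ^ 2) =
      cexp (-((s : ℂ) * ((‖x‖ ^ 2 : ℝ) : ℂ)) / (2 * (1 + I * s * t))) *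
      cexp ((starRingEnd ℂ) (-((s : ℂ) * ((‖x‖ ^ 2 : ℝ) : ℂ)) / (2 * (1 + I * s * t)))) ^ 2 := by
    rw [hexp]
    congr 1
    simp only [map_div₀, map_neg, map_mul, map_add, map_one, conj_ofReal, conj_I, map_ofNat]
    push_cast
    rw [h3, show (1 : ℂ) + -I * s * t = 1 - I * s * t by ring,
      show (3 : ℂ) + I * (s * t) = (1 - I * s * t) + 2 * (1 + I * s * t) by ring]
    generalize (1 : ℂ) + I * s * t = p at h1
    generalize (1 : ℂ) - I * s * t = q at h2
    field_simp
    ring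
  rw [hE]
  ring

theorem norm_integral_gaussEvol_mul_conj_sq (n : ℕ) (b l t : ℝ) (hl : 0 < l) :
    ‖∫ x, gaussEvol n b l t x * (starRingEnd ℂ) (gaussEvol n b l t x) ^ 2‖ =
      (2 * π * l ^ b / (√(1 + (l ^ (2 * b) * t) ^ 2) * √(9 + (l ^ (2 * b) * t) ^ 2))) ^
        ((n : ℝ) / 2) := by
  have hw : 0 < l ^ b := Real.rpow_pos_of_pos hl b
  have hs : l ^ (2 * b) = (l ^ b) ^ 2 := by
    rw [mul_comm, Real.rpow_mul hl.le]; norm_num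
  have hA : l ^ ((n : ℝ) * b / 2) = (l ^ b) ^ ((n : ℝ) / 2) := by
    rw [← Real.rpow_mul hl.le]; ring_nf
  simp_rw [gaussEvol_mul_conj_sq]
  rw [hs, hA]
  generalize l ^ b = w at hw
  set u := w ^ 2 * t with hu
  have hr : 0 < √(1 + u ^ 2) := Real.sqrt_pos.2 (by positivity)
  have hq : 0 < √(9 + u ^ 2) := Real.sqrt_pos.2 (by positivity)
  have hr2 : √(1 + u ^ 2) ^ 2 = 1 + u ^ 2 := Real.sq_sqrt (by positivity)
  have hz : ‖(1 : ℂ) + I * ((w ^ 2 : ℝ) : ℂ) * (t : ℂ)‖ = √(1 + u ^ 2) := by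
    have h := Complex.norm_add_mul_I 1 u
    rw [one_pow] at h
    rw [← h, hu]
    congr 1
    push_cast
    ring
  have hv : ‖(3 : ℂ) + I * (u : ℂ)‖ = √(9 + u ^ 2) := by
    have h := Complex.norm_add_mul_I 3 u
    rw [show (3 : ℝ) ^ 2 = 9 by norm_num] at h
    rw [← h]
    congr 1
    push_cast
    ring
  have hre : 0 < (((w ^ 2 : ℝ) : ℂ) * (3 + I * (u : ℂ)) / (2 * ((1 + u ^ 2 : ℝ) : ℂ))).re := by
    rw [show ((w ^ 2 : ℝ) : ℂ) * (3 + I * (u : ℂ)) / (2 * ((1 + u ^ 2 : ℝ) : ℂ)) =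
      ((w ^ 2 / (2 * (1 + u ^ 2)) : ℝ) : ℂ) * (3 + I * (u : ℂ)) by push_cast; ring,
      Complex.re_ofReal_mul]
    have : ((3 : ℂ) + I * (u : ℂ)).re = 3 := by simp
    rw [this]
    positivity
  rw [integral_const_mul, GaussianFourier.integral_cexp_neg_mul_sq_norm hre,
    finrank_euclideanSpace_fin,
    show ((n : ℂ) / 2) = (((n : ℝ) / 2 : ℝ) : ℂ) by push_cast; rfl,
    show (-(n : ℂ) / 2) = ((-((n : ℝ) / 2) : ℝ) : ℂ) by push_cast; ring]
  simp only [norm_mul, norm_pow, RCLike.norm_conj, Complex.norm_cpow_real, norm_div, hz, hv,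
    Complex.norm_real, Complex.norm_ofNat, Real.norm_eq_abs]
  rw [abs_of_pos (Real.rpow_pos_of_pos hw _), abs_of_pos Real.pi_pos, abs_of_pos hw,
    abs_of_pos (by positivity : (0 : ℝ) < 1 + u ^ 2), Real.rpow_neg hr.le,
    ← Real.inv_rpow hr.le, Real.rpow_pow_comm hw.le, Real.rpow_pow_comm (inv_nonneg.2 hr.le),
    ← Real.mul_rpow (by positivity) (by positivity),
    ← Real.mul_rpow (by positivity) (by positivity),
    ← Real.mul_rpow (by positivity) (by positivity)]
  congr 1
  field_simp
  rw [hr2]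

/-- For the evolved Gaussian wave packet `g_{λ,t}` (case of the nonlinearity
`𝒩[u] = u²`), for `t₀ > 0` there is `C > 0` depending only on `n` and `t₀` such that for all
`0 < b < 1` and `λ ≥ 1`:
(a) if `|t| ≤ λ^{-2nb}` then `|∫ g conj(g)²| ≥ C λ^{nb/2}`;
(b) if `λ^{-2nb} ≤ |t| ≤ t₀` then `|∫ g conj(g)²| ≥ C λ^{-3nb/2}`. -/
theorem gaussEvol_inner_sq_lower (n : ℕ) (hn : 1 ≤ n) (t₀ : ℝ) (ht₀ : 0 < t₀) :
    ∃ C > (0 : ℝ), ∀ b : ℝ, 0 < b → b < 1 → ∀ l : ℝ, 1 ≤ l → ∀ t : ℝ,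
      (|t| ≤ l ^ (-(2 * (n : ℝ) * b)) →
        C * l ^ ((n : ℝ) * b / 2)
          ≤ ‖∫ x, gaussEvol n b l t x * (starRingEnd ℂ) (gaussEvol n b l t x) ^ 2‖) ∧
      (l ^ (-(2 * (n : ℝ) * b)) ≤ |t| → |t| ≤ t₀ →
        C * l ^ (-(3 * (n : ℝ) * b / 2))
          ≤ ‖∫ x, gaussEvol n b l t x * (starRingEnd ℂ) (gaussEvol n b l t x) ^ 2‖) := by
  refine ⟨(2 * π / (10 + t₀ ^ 2)) ^ ((n : ℝ) / 2), by positivity, fun b hb _ l hl t => ?_⟩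
  have hl0 : 0 < l := one_pos.trans_le hl
  have hn' : (1 : ℝ) ≤ n := by exact_mod_cast hn
  have hw : 0 < l ^ b := Real.rpow_pos_of_pos hl0 b
  have hs : l ^ (2 * b) = (l ^ b) ^ 2 := by
    rw [mul_comm, Real.rpow_mul hl0.le]; norm_num
  have hw1 : 1 ≤ l ^ b := Real.one_le_rpow hl hb.le
  have hrq : √(1 + (l ^ (2 * b) * t) ^ 2) * √(9 + (l ^ (2 * b) * t) ^ 2) ≤
      9 + (l ^ (2 * b) * t) ^ 2 := by
    calc _ ≤ √(9 + (l ^ (2 * b) * t) ^ 2) * √(9 + (l ^ (2 * b) * t) ^ 2) := by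
          gcongr; norm_num
      _ = _ := Real.mul_self_sqrt (by positivity)
  have hpos : 0 < √(1 + (l ^ (2 * b) * t) ^ 2) * √(9 + (l ^ (2 * b) * t) ^ 2) :=
    mul_pos (Real.sqrt_pos.2 (by positivity)) (Real.sqrt_pos.2 (by positivity))
  rw [norm_integral_gaussEvol_mul_conj_sq n b l t hl0]
  refine ⟨fun ht => ?_, fun _ ht => ?_⟩
  · have hA : l ^ ((n : ℝ) * b / 2) = (l ^ b) ^ ((n : ℝ) / 2) := by
      rw [← Real.rpow_mul hl0.le]; ring_nf
    have hu : |l ^ (2 * b) * t| ≤ 1 := by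
      rw [abs_mul, abs_of_pos (Real.rpow_pos_of_pos hl0 _)]
      calc l ^ (2 * b) * |t| ≤ l ^ (2 * b) * l ^ (-(2 * (n : ℝ) * b)) := by gcongr
        _ = l ^ (2 * b + -(2 * (n : ℝ) * b)) := (Real.rpow_add hl0 _ _).symm
        _ ≤ 1 := Real.rpow_le_one_of_one_le_of_nonpos hl (by nlinarith)
    have hu2 : (l ^ (2 * b) * t) ^ 2 ≤ 1 := (sq_le_one_iff_abs_le_one _).2 hu
    rw [hA, ← Real.mul_rpow (by positivity) hw.le, div_mul_eq_mul_div]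
    gcongr
    nlinarith [sq_nonneg t₀]
  · have hA : l ^ (-(3 * (n : ℝ) * b / 2)) = (((l ^ b) ^ 3)⁻¹) ^ ((n : ℝ) / 2) := by
      rw [← Real.rpow_natCast, ← Real.rpow_neg hw.le, ← Real.rpow_mul hl0.le,
        ← Real.rpow_mul hl0.le]
      congr 1
      push_cast
      ring
    have ht2 : t ^ 2 ≤ t₀ ^ 2 := sq_le_sq.2 (ht.trans (le_abs_self _))
    have hw4 : 1 ≤ (l ^ b) ^ 4 := one_le_pow₀ hw1
    rw [hA, ← Real.mul_rpow (by positivity) (by positivity)]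
    refine Real.rpow_le_rpow (by positivity) ?_ (by positivity)
    rw [← div_eq_mul_inv, div_div, div_le_div_iff₀ (by positivity) hpos, hs] at *
    have hK : √(1 + ((l ^ b) ^ 2 * t) ^ 2) * √(9 + ((l ^ b) ^ 2 * t) ^ 2) ≤
        (l ^ b) ^ 4 * (10 + t₀ ^ 2) := hrq.trans (by nlinarith)
    calc _ ≤ 2 * π * ((l ^ b) ^ 4 * (10 + t₀ ^ 2)) := by gcongr
      _ = _ := by ring
end

section
/- Let n ≥ 1, p, q ∈ ℕ with p + q ≥ 1, and 0 < b < 1. Define g_{λ,t}(x) = λ^{nb/2} (1 + i λ^{2b} t)^{−n/2} exp( − λ^{2b} |x|² / (2(1 + i λ^{2b} t)) ) (principal branch). Then there exists C > 0, depending only on n, p, q, such that for all λ ≥ 1 and all t ∈ ℝ, ‖ g_{λ,t}^{p} · conj(g_{λ,t})^{q} ‖_{L²(ℝⁿ)} ≤ C λ^{nb(p+q−1)/2}. -/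
open MeasureTheory Complex Real
open scoped InnerProductSpace ENNReal

/-- The modulus of the evolved Gaussian is again a Gaussian. -/
lemma norm_gaussEvol (n : ℕ) (b : ℝ) {l : ℝ} (hl : 0 < l) (t : ℝ) (x : EuclideanSpace ℝ (Fin n)) :
    ‖gaussEvol n b l t x‖ =
      l ^ ((n : ℝ) * b / 2) * (1 + (l ^ (2 * b) * t) ^ 2) ^ (-(n : ℝ) / 4) *
        Real.exp (-(l ^ (2 * b) / (2 * (1 + (l ^ (2 * b) * t) ^ 2))) * ‖x‖ ^ 2) := by
  have hD : 0 < 1 + (l ^ (2 * b) * t) ^ 2 := by positivity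
  unfold gaussEvol
  generalize l ^ (2 * b) = a at hD ⊢
  have hsq : Complex.normSq (1 + Complex.I * (a : ℂ) * (t : ℂ)) = 1 + (a * t) ^ 2 := by
    simp [Complex.normSq_apply]
    ring
  have hnorm : ‖(1 : ℂ) + Complex.I * (a : ℂ) * (t : ℂ)‖ = (1 + (a * t) ^ 2) ^ (1 / 2 : ℝ) := by
    rw [← Real.sqrt_eq_rpow, ← hsq, Complex.norm_def]
  have hexp : -(n : ℂ) / 2 = ((-(n : ℝ) / 2 : ℝ) : ℂ) := by push_cast; rfl
  rw [norm_mul, norm_mul, Complex.norm_exp, hexp, Complex.norm_cpow_real, hnorm,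
    Complex.norm_real, Real.norm_of_nonneg (by positivity), ← Real.rpow_mul hD.le]
  have hre : (-((a : ℂ) * ((‖x‖ ^ 2 : ℝ) : ℂ)) /
      (2 * ((1 : ℂ) + Complex.I * (a : ℂ) * (t : ℂ)))).re =
      -(a / (2 * (1 + (a * t) ^ 2))) * ‖x‖ ^ 2 := by
    rw [Complex.div_re, Complex.normSq_mul, hsq, ← Complex.ofReal_mul, ← Complex.ofReal_neg,
      Complex.ofReal_re, Complex.ofReal_im]
    simp
    field_simp
  rw [hre]
  congr 3
  ring

/-- The `L²` norm of a real Gaussian on `ℝⁿ`. -/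
lemma eLpNorm_two_rexp_neg_mul_sq_norm (n : ℕ) {c : ℝ} (hc : 0 < c) :
    eLpNorm (fun x : EuclideanSpace ℝ (Fin n) => Real.exp (-c * ‖x‖ ^ 2)) 2 volume =
      ENNReal.ofReal ((π / (2 * c)) ^ ((n : ℝ) / 4)) := by
  have hint := GaussianFourier.integral_rexp_neg_mul_sq_norm
    (V := EuclideanSpace ℝ (Fin n)) (b := 2 * c) (by positivity)
  have hpos : 0 < (π / (2 * c)) ^ ((n : ℝ) / 2) := by positivity
  rw [finrank_euclideanSpace_fin] at hint
  have hintegrable : Integrable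
      (fun x : EuclideanSpace ℝ (Fin n) => Real.exp (-(2 * c) * ‖x‖ ^ 2)) :=
    Integrable.of_integral_ne_zero (by rw [hint]; exact hpos.ne')
  rw [eLpNorm_eq_lintegral_rpow_enorm_toReal two_ne_zero ENNReal.ofNat_ne_top]
  have hpt : ∀ x : EuclideanSpace ℝ (Fin n),
      ‖Real.exp (-c * ‖x‖ ^ 2)‖ₑ ^ (2 : ℝ≥0∞).toReal =
        ENNReal.ofReal (Real.exp (-(2 * c) * ‖x‖ ^ 2)) := fun x => by
    rw [Real.enorm_of_nonneg (Real.exp_pos _).le,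
      ENNReal.ofReal_rpow_of_nonneg (Real.exp_pos _).le (by simp), ← Real.exp_mul]
    congr 2
    simp
    ring
  simp_rw [hpt]
  rw [← ofReal_integral_eq_lintegral_ofReal hintegrable
      (Filter.Eventually.of_forall fun x => (Real.exp_pos _).le), hint,
    ENNReal.ofReal_rpow_of_nonneg hpos.le (by simp), ← Real.rpow_mul (by positivity)]
  congr 2
  simp
  ring

/-- For the evolved Gaussian wave packet `g_{λ,t}` and the power nonlinearity
`𝒩[g] = g^p ḡ^q` with `p + q ≥ 1`, there is `C > 0` depending only on `n, p, q` such that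
`‖g_{λ,t}^p conj(g_{λ,t})^q‖_{L²(ℝⁿ)} ≤ C λ^{nb(p+q-1)/2}` for all `0 < b < 1`, `λ ≥ 1`, `t ∈ ℝ`. -/
theorem gaussEvol_nonlinearity_L2_upper (n : ℕ) (hn : 1 ≤ n) (p q : ℕ) (hpq : 1 ≤ p + q) :
    ∃ C > (0 : ℝ), ∀ b : ℝ, 0 < b → b < 1 → ∀ l : ℝ, 1 ≤ l → ∀ t : ℝ,
      eLpNorm (fun x => gaussEvol n b l t x ^ p * (starRingEnd ℂ) (gaussEvol n b l t x) ^ q)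
          2 volume
        ≤ ENNReal.ofReal (C * l ^ ((n : ℝ) * b * ((p : ℝ) + (q : ℝ) - 1) / 2)) := by
  refine ⟨π ^ ((n : ℝ) / 4), by positivity, fun b _ _ l hl t => ?_⟩
  have hl0 : 0 < l := one_pos.trans_le hl
  have hm : (1 : ℝ) ≤ (p : ℝ) + q := by exact_mod_cast hpq
  set m : ℝ := (p : ℝ) + q with hmdef
  have hm0 : 0 < m := one_pos.trans_le hm
  set D : ℝ := 1 + (l ^ (2 * b) * t) ^ 2 with hDdef
  have hD1 : 1 ≤ D := by rw [hDdef]; nlinarith [sq_nonneg (l ^ (2 * b) * t)]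
  have hD : 0 < D := one_pos.trans_le hD1
  set A : ℝ := (l ^ ((n : ℝ) * b / 2) * D ^ (-(n : ℝ) / 4)) ^ m with hA
  have hA0 : 0 ≤ A := by positivity
  have hpt : ∀ x : EuclideanSpace ℝ (Fin n),
      ‖gaussEvol n b l t x ^ p * (starRingEnd ℂ) (gaussEvol n b l t x) ^ q‖ =
        ‖(A • fun x : EuclideanSpace ℝ (Fin n) =>
          Real.exp (-(m * l ^ (2 * b) / (2 * D)) * ‖x‖ ^ 2)) x‖ := fun x => by
    rw [norm_mul, norm_pow, norm_pow, RCLike.norm_conj, ← pow_add, norm_gaussEvol n b hl0 t x,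
      ← hDdef, ← Real.rpow_natCast, Nat.cast_add, ← hmdef,
      Real.mul_rpow (by positivity) (Real.exp_pos _).le, ← hA, ← Real.exp_mul, Pi.smul_apply,
      smul_eq_mul, Real.norm_of_nonneg (by positivity)]
    congr 2
    ring
  rw [eLpNorm_congr_norm_ae (Filter.Eventually.of_forall hpt), eLpNorm_const_smul,
    eLpNorm_two_rexp_neg_mul_sq_norm n (by positivity), Real.enorm_of_nonneg hA0,
    ← ENNReal.ofReal_mul hA0]
  apply ENNReal.ofReal_le_ofReal
  have hval : π / (2 * (m * l ^ (2 * b) / (2 * D))) = π * (D * (l ^ (-(2 * b)) * m⁻¹)) := by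
    rw [Real.rpow_neg hl0.le]
    field_simp
  rw [hval, hA, Real.mul_rpow (by positivity) (by positivity),
    Real.mul_rpow (by positivity) (by positivity), Real.mul_rpow (by positivity) (by positivity),
    Real.mul_rpow (by positivity) (by positivity), ← Real.rpow_mul hl0.le, ← Real.rpow_mul hD.le,
    ← Real.rpow_mul hl0.le]
  have hDle : D ^ (-(n : ℝ) / 4 * m) * D ^ ((n : ℝ) / 4) ≤ 1 := by
    rw [← Real.rpow_add hD]
    refine Real.rpow_le_one_of_one_le_of_nonpos hD1 ?_
    nlinarith [mul_nonneg (Nat.cast_nonneg (α := ℝ) n) (sub_nonneg.2 hm)]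
  have hmle : m⁻¹ ^ ((n : ℝ) / 4) ≤ 1 :=
    Real.rpow_le_one (by positivity) (inv_le_one_of_one_le₀ hm) (by positivity)
  have hlpow : l ^ ((n : ℝ) * b * (m - 1) / 2) =
      l ^ ((n : ℝ) * b / 2 * m) * l ^ (-(2 * b) * ((n : ℝ) / 4)) := by
    rw [← Real.rpow_add hl0]
    congr 1
    ring
  rw [hlpow]
  calc _ = π ^ ((n : ℝ) / 4) *
        (l ^ ((n : ℝ) * b / 2 * m) * l ^ (-(2 * b) * ((n : ℝ) / 4))) *
        ((D ^ (-(n : ℝ) / 4 * m) * D ^ ((n : ℝ) / 4)) * m⁻¹ ^ ((n : ℝ) / 4)) := by ring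
    _ ≤ _ := mul_le_of_le_one_right (by positivity)
        (mul_le_one₀ hDle (by positivity) hmle)
end
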